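/- arXiv:1801.02287 — 2 statements merged into one kernel-verified Lean document; each statement's English description precedes it below -/
import Mathlib

section
/- (Lemma 4) Let L ≥ 1, nI ≥ 1, k ≥ 1 and χ ≥ 1 be integers, set n = L·nI, α = (nI − 1)χ + (n − nI), q = ⌊k/nI⌋ and r = k mod nI. Then for every contact vector ω = (ω_1,…,ω_L) (integers with 0 ≤ ω_l ≤ nI and Σ_{l=1}^{L} ω_l = k), one has k·α − k(k−1)/2 − (χ−1)·Σ_{l=1}^{L} ω_l(ω_l−1)/2 ≥ k·α − (χ−1)·(q·nI² + r² − k)/2 − k(k−1)/2. -/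
/-- Adding a part `b ≤ N` to `a` raises `(a / N) * N ^ 2 + (a % N) ^ 2` by at least `b ^ 2`. -/
theorem div_mul_sq_add_mod_sq_add_sq_le {N : ℕ} (hN : 0 < N) (a b : ℕ) (hb : b ≤ N) :
    (a / N) * N ^ 2 + (a % N) ^ 2 + b ^ 2 ≤ ((a + b) / N) * N ^ 2 + ((a + b) % N) ^ 2 := by
  have hr : a % N < N := Nat.mod_lt a hN
  have ha : N * (a / N) + a % N = a := Nat.div_add_mod a N
  generalize a / N = q at *
  generalize a % N = r at *
  subst ha
  rcases lt_or_ge (r + b) N with h | h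
  · rw [add_assoc (N * q), Nat.mul_add_div hN, Nat.mul_add_mod, Nat.div_eq_of_lt h, Nat.mod_eq_of_lt h]
    nlinarith [Nat.zero_le (r * b)]
  · obtain ⟨c, hc⟩ := Nat.exists_eq_add_of_le h
    have hcN : c < N := by omega
    have hsplit : N * q + r + b = N * (q + 1) + c := by rw [add_assoc, hc]; ring
    rw [hsplit, Nat.mul_add_div hN, Nat.mul_add_mod, Nat.div_eq_of_lt hcN, Nat.mod_eq_of_lt hcN]
    zify at *
    rw [show (c : ℤ) = r + b - N by linarith]
    nlinarith [mul_nonneg (sub_nonneg.2 hr.le) (sub_nonneg.2 hb)]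

/-- A sum of squares of naturals bounded by `N` is largest when the parts are packed greedily. -/
theorem sum_sq_le_div_mul_sq_add_mod_sq {ι : Type*} {N : ℕ} (hN : 0 < N) (s : Finset ι)
    (f : ι → ℕ) (hf : ∀ i, f i ≤ N) :
    ∑ i ∈ s, f i ^ 2 ≤ ((∑ i ∈ s, f i) / N) * N ^ 2 + ((∑ i ∈ s, f i) % N) ^ 2 := by
  classical
  induction s using Finset.induction_on with
  | empty => simp
  | insert i s hi ih =>
    rw [Finset.sum_insert hi, Finset.sum_insert hi, add_comm, add_comm (f i)]
    exact (Nat.add_le_add_right ih _).trans (div_mul_sq_add_mod_sq_add_sq_le hN _ _ (hf i))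


/-- Lemma 4: for any contact vector ω,
`kα − k(k−1)/2 − (χ−1) Σ_l ω_l(ω_l−1)/2 ≥ kα − (χ−1)(q nI² + r² − k)/2 − k(k−1)/2`. -/
theorem clustered_mbr_retrieval_lower_bound_nonzero_eps (L nI k χ : ℕ)
    (hL : 1 ≤ L) (hnI : 1 ≤ nI) (hk : 1 ≤ k) (hχ : 1 ≤ χ)
    (n : ℕ) (hn : n = L * nI)
    (α : ℕ) (hα : α = (nI - 1) * χ + (n - nI))
    (q r : ℕ) (hq : q = k / nI) (hr : r = k % nI)
    (ω : Fin L → ℕ) (hω : ∀ l, ω l ≤ nI) (hsum : ∑ l, ω l = k) :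
    (k : ℤ) * (α : ℤ) - (k : ℤ) * ((k : ℤ) - 1) / 2 -
        ((χ : ℤ) - 1) * ∑ l, ((ω l : ℤ) * ((ω l : ℤ) - 1)) / 2 ≥
      (k : ℤ) * (α : ℤ) - ((χ : ℤ) - 1) * ((q : ℤ) * (nI : ℤ) ^ 2 + (r : ℤ) ^ 2 - (k : ℤ)) / 2 -
        (k : ℤ) * ((k : ℤ) - 1) / 2 := by
  have hsq := sum_sq_le_div_mul_sq_add_mod_sq hnI Finset.univ ω hω
  rw [hsum, ← hq, ← hr] at hsq
  have hpairs : 2 * ∑ l, ((ω l : ℤ) * ((ω l : ℤ) - 1)) / 2 = ∑ l, (ω l : ℤ) ^ 2 - k := by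
    rw [← hsum, Nat.cast_sum, ← Finset.sum_sub_distrib, Finset.mul_sum]
    refine Finset.sum_congr rfl fun l _ => ?_
    rw [Int.mul_ediv_cancel' (Int.even_mul_pred_self _).two_dvd]
    ring
  have hχ' : (0 : ℤ) ≤ (χ : ℤ) - 1 := by omega
  zify at hsq
  have hle : ((χ : ℤ) - 1) * ∑ l, ((ω l : ℤ) * ((ω l : ℤ) - 1)) / 2 ≤
      ((χ : ℤ) - 1) * ((q : ℤ) * (nI : ℤ) ^ 2 + (r : ℤ) ^ 2 - (k : ℤ)) / 2 := by
    rw [Int.le_ediv_iff_mul_le two_pos, mul_assoc]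
    exact mul_le_mul_of_nonneg_left (by linarith) hχ'
  linarith
end

section
/- (Theorem 2, exact regeneration) In the Algorithm-2 storage structure with L ≥ 1, nI ≥ 2, n = L·nI and χ ≥ 1, for every node v: every coded symbol stored by v is stored by exactly one other node; the set of symbols stored by v is the disjoint union, over all other nodes u, of the intersections symbols(v) ∩ symbols(u), where |symbols(v) ∩ symbols(u)| = χ if u lies in the same cluster as v and |symbols(v) ∩ symbols(u)| = 1 otherwise. Hence a failed node (storing α = (nI−1)χ + (n−nI) symbols) is exactly regenerated by downloading β_I = χ symbols from each of the nI − 1 other nodes of its cluster and β_c = 1 symbol from each of the n − nI nodes of other clusters. -/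
/-- Node `(l,j)` (0-indexed) of the clustered system is identified with element
`nI·l + j` of `{0,…,L·nI − 1}`. -/
def clusterIdx {L nI : ℕ} (v : Fin L × Fin nI) : Fin (L * nI) :=
  ⟨nI * v.1.val + v.2.val, by
    have h1 : v.1.val + 1 ≤ L := v.1.isLt
    have h2 : v.2.val < nI := v.2.isLt
    calc nI * v.1.val + v.2.val < nI * v.1.val + nI := Nat.add_lt_add_left h2 _
      _ = nI * (v.1.val + 1) := by ring
      _ ≤ nI * L := Nat.mul_le_mul_left nI h1
      _ = L * nI := Nat.mul_comm nI L⟩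

/-- The coded symbols of the Algorithm-2 storage structure: a global symbol for each edge
of the complete graph on the `n = L·nI` node indices, and a local symbol for each cluster
`l`, each `t ∈ {1,…,χ−1}` and each edge of the complete graph on `{1,…,nI}`. -/
def AlgTwoSymbol (L nI χ : ℕ) : Type :=
  {e : Sym2 (Fin (L * nI)) // ¬ e.IsDiag} ⊕
    (Fin L × Fin (χ - 1) × {e : Sym2 (Fin nI) // ¬ e.IsDiag})

/-- Node `(l,j)` stores a global symbol `e` iff its index is an endpoint of `e`, and stores
a local symbol `(l',t,e')` iff `l = l'` and `j` is an endpoint of `e'`. -/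
def algTwoStores {L nI χ : ℕ} (v : Fin L × Fin nI) (s : AlgTwoSymbol L nI χ) : Prop :=
  match s with
  | Sum.inl e => clusterIdx v ∈ e.val
  | Sum.inr w => v.1 = w.1 ∧ v.2 ∈ w.2.2.val

theorem clusterIdx_injective {L nI : ℕ} :
    Function.Injective (clusterIdx : Fin L × Fin nI → Fin (L * nI)) := by
  rintro ⟨a, b⟩ ⟨c, d⟩ h
  have hmod := congrArg (fun x : Fin (L * nI) => x.val % nI) h
  have hdiv := congrArg (fun x : Fin (L * nI) => x.val / nI) h
  have hpos : 0 < nI := b.pos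
  simp only [clusterIdx, Nat.mul_add_mod, Nat.mod_eq_of_lt b.isLt,
    Nat.mod_eq_of_lt d.isLt] at hmod
  simp only [clusterIdx, Nat.mul_add_div hpos, Nat.div_eq_of_lt b.isLt,
    Nat.div_eq_of_lt d.isLt, Nat.add_zero] at hdiv
  exact Prod.ext (Fin.ext hdiv) (Fin.ext hmod)

theorem clusterIdx_bijective {L nI : ℕ} :
    Function.Bijective (clusterIdx : Fin L × Fin nI → Fin (L * nI)) :=
  (Fintype.bijective_iff_injective_and_card _).2 ⟨clusterIdx_injective, by simp⟩

/-- A non-loop containing `a` has exactly one other endpoint. -/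
theorem Sym2.existsUnique_ne_mem {α : Type*} {a : α} {e : Sym2 α} (he : ¬ e.IsDiag)
    (ha : a ∈ e) : ∃! b, b ≠ a ∧ b ∈ e := by
  obtain ⟨b, rfl⟩ := ha
  have hab : a ≠ b := by simpa using he
  refine ⟨b, ⟨hab.symm, Sym2.mem_mk_right a b⟩, ?_⟩
  rintro c ⟨hca, hc⟩
  exact (Sym2.mem_iff.1 hc).resolve_left hca

/-- Every symbol stored by `v` is stored by exactly one other node. -/
theorem algTwoStores_existsUnique_ne {L nI χ : ℕ} {v : Fin L × Fin nI}
    {s : AlgTwoSymbol L nI χ} (hs : algTwoStores v s) :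
    ∃! u, u ≠ v ∧ algTwoStores u s := by
  rcases s with e | ⟨l, t, e⟩
  · obtain ⟨b, ⟨hbv, hb⟩, huniq⟩ := Sym2.existsUnique_ne_mem e.2 hs
    obtain ⟨u, rfl⟩ := clusterIdx_bijective.2 b
    refine ⟨u, ⟨fun h => hbv (congrArg _ h), hb⟩, ?_⟩
    rintro w ⟨hwv, hw⟩
    exact clusterIdx_injective (huniq _ ⟨clusterIdx_injective.ne hwv, hw⟩)
  · obtain ⟨rfl, hj⟩ := hs
    obtain ⟨b, ⟨hbv, hb⟩, huniq⟩ := Sym2.existsUnique_ne_mem e.2 hj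
    refine ⟨(v.1, b), ⟨fun h => hbv (congrArg Prod.snd h), rfl, hb⟩, ?_⟩
    rintro w ⟨hwv, hw, hwe⟩
    exact Prod.ext hw (huniq _ ⟨fun h => hwv (Prod.ext hw h), hwe⟩)

/-- The global symbol shared by two distinct nodes. -/
def sharedGlobal {L nI : ℕ} (χ : ℕ) {u v : Fin L × Fin nI} (h : u ≠ v) :
    AlgTwoSymbol L nI χ :=
  Sum.inl ⟨s(clusterIdx v, clusterIdx u), by simpa using clusterIdx_injective.ne h.symm⟩

/-- The symbols shared by two nodes `(l,i)` and `(l,j)`, with `none` for the global one. -/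
def sharedSymbol {L nI χ : ℕ} (l : Fin L) {i j : Fin nI} (h : i ≠ j) :
    Option (Fin (χ - 1)) → AlgTwoSymbol L nI χ
  | none => sharedGlobal χ (u := (l, i)) (v := (l, j)) fun h' => h (congrArg Prod.snd h')
  | some t => Sum.inr (l, t, ⟨s(j, i), by simpa using h.symm⟩)

theorem sharedSymbol_injective {L nI χ : ℕ} {l : Fin L} {i j : Fin nI} (h : i ≠ j) :
    Function.Injective (sharedSymbol (χ := χ) l h) := by
  rintro (_ | s) (_ | t) hst
  · rfl
  · cases hst
  · cases hst
  · exact congrArg some (congrArg (fun w => w.2.1) (Sum.inr.inj hst))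

theorem algTwoStores_inl_and_iff {L nI χ : ℕ} {u v : Fin L × Fin nI} (h : u ≠ v)
    (e : {e : Sym2 (Fin (L * nI)) // ¬ e.IsDiag}) :
    (algTwoStores (χ := χ) v (Sum.inl e) ∧ algTwoStores (χ := χ) u (Sum.inl e)) ↔
      (Sum.inl e : AlgTwoSymbol L nI χ) = sharedGlobal χ h :=
  (Sym2.mem_and_mem_iff (clusterIdx_injective.ne h.symm)).trans
    ⟨fun he => congrArg Sum.inl (Subtype.ext he),
      fun he => congrArg Subtype.val (Sum.inl.inj he)⟩

theorem inter_eq_range_sharedSymbol {L nI χ : ℕ} {l : Fin L} {i j : Fin nI} (h : i ≠ j) :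
    ({s : AlgTwoSymbol L nI χ | algTwoStores (l, j) s} ∩ {s | algTwoStores (l, i) s}) =
      Set.range (sharedSymbol l h) := by
  ext s
  have hne : (l, i) ≠ (l, j) := fun h' => h (congrArg Prod.snd h')
  rcases s with e | ⟨k, t, e⟩
  · refine (algTwoStores_inl_and_iff hne e).trans ⟨fun he => ⟨none, he.symm⟩, ?_⟩
    rintro ⟨_ | t, ht⟩
    · exact ht.symm
    · cases ht
  · constructor
    · rintro ⟨⟨hk, hj⟩, -, hi⟩
      cases hk
      have he : e.1 = s(j, i) := (Sym2.mem_and_mem_iff h.symm).1 ⟨hj, hi⟩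
      exact ⟨some t, congrArg (fun e => Sum.inr (l, t, e)) (Subtype.ext he.symm)⟩
    · rintro ⟨_ | t', ht⟩
      · cases ht
      · cases ht
        exact ⟨⟨rfl, Sym2.mem_mk_left j i⟩, rfl, Sym2.mem_mk_right j i⟩

theorem inter_eq_singleton_sharedGlobal {L nI χ : ℕ} {u v : Fin L × Fin nI} (h : u ≠ v)
    (hc : u.1 ≠ v.1) :
    ({s : AlgTwoSymbol L nI χ | algTwoStores v s} ∩ {s | algTwoStores u s}) =
      {sharedGlobal χ h} := by
  ext s
  rcases s with e | w
  · exact algTwoStores_inl_and_iff h e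
  · constructor
    · rintro ⟨⟨hv, -⟩, hu, -⟩
      exact absurd (hu.trans hv.symm) hc
    · intro hw
      cases hw

/-- Theorem 2 (exact regeneration): in the Algorithm-2 storage structure, each symbol of a
node `v` is stored by exactly one other node; the symbols of `v` form the disjoint union,
over the other nodes `u`, of the intersections with `u`'s symbols, of size `χ` if `u` is
in the same cluster and `1` otherwise.  Hence a failed node is regenerated with
`β_I = χ`, `β_c = 1`. -/
theorem algorithm2_exact_regeneration (L nI χ : ℕ) (hL : 1 ≤ L) (hnI : 2 ≤ nI) (hχ : 1 ≤ χ) :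
    ∀ v : Fin L × Fin nI,
      (∀ s : AlgTwoSymbol L nI χ, algTwoStores v s →
        {u | u ≠ v ∧ algTwoStores u s}.ncard = 1) ∧
      ({s : AlgTwoSymbol L nI χ | algTwoStores v s} =
        ⋃ u ∈ {u : Fin L × Fin nI | u ≠ v},
          ({s | algTwoStores v s} ∩ {s | algTwoStores u s})) ∧
      (∀ u₁ u₂ : Fin L × Fin nI, u₁ ≠ v → u₂ ≠ v → u₁ ≠ u₂ →
        Disjoint
          ({s : AlgTwoSymbol L nI χ | algTwoStores v s} ∩ {s | algTwoStores u₁ s})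
          ({s : AlgTwoSymbol L nI χ | algTwoStores v s} ∩ {s | algTwoStores u₂ s})) ∧
      (∀ u : Fin L × Fin nI, u ≠ v →
        ({s : AlgTwoSymbol L nI χ | algTwoStores v s} ∩ {s | algTwoStores u s}).ncard =
          if u.1 = v.1 then χ else 1) := by
  intro v
  refine ⟨fun s hs => ?_, ?_, fun u₁ u₂ h₁ h₂ h₁₂ => ?_, fun u hu => ?_⟩
  · obtain ⟨u, hu, huniq⟩ := algTwoStores_existsUnique_ne hs
    exact Set.ncard_eq_one.2 ⟨u, Set.eq_singleton_iff_unique_mem.2 ⟨hu, huniq⟩⟩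
  · ext s
    simp only [Set.mem_iUnion, Set.mem_inter_iff, Set.mem_ofPred_eq, exists_prop]
    constructor
    · intro hs
      obtain ⟨u, ⟨huv, hu⟩, -⟩ := algTwoStores_existsUnique_ne hs
      exact ⟨u, huv, hs, hu⟩
    · rintro ⟨-, -, hs, -⟩
      exact hs
  · refine Set.disjoint_left.2 fun s hs₁ hs₂ => h₁₂ ?_
    exact (algTwoStores_existsUnique_ne hs₁.1).unique ⟨h₁, hs₁.2⟩ ⟨h₂, hs₂.2⟩
  · split_ifs with hc
    · obtain ⟨l, j⟩ := v
      obtain ⟨k, i⟩ := u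
      obtain rfl : k = l := hc
      have hij : i ≠ j := fun h => hu (congrArg (Prod.mk k) h)
      rw [inter_eq_range_sharedSymbol hij, ← Set.image_univ,
        Set.ncard_image_of_injective _ (sharedSymbol_injective hij), Set.ncard_univ]
      simp [Nat.sub_add_cancel hχ]
    · rw [inter_eq_singleton_sharedGlobal hu hc, Set.ncard_singleton]
end
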